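/- Let 0 < q < 1, let z be real with 0 ≤ z < 1, and let k̃ and l̃ be augmented indices. Then the first q-connected sum satisfies the transport relations: (i) L̃i_q^{(1)}(w(k̃)y_0; w(l̃); z) = L̃i_q^{(1)}(w(k̃); w(l̃)y_0; z); and (ii) if l̃ is non-empty, L̃i_q^{(1)}(w(k̃)y_1; w(l̃); z) = L̃i_q^{(1)}(w(k̃); w(l̃)x; z). -/

import Mathlib

/-- The q-integer [m] = (1 − q^m)/(1 − q). -/
noncomputable def qInt (q : ℝ) (m : ℕ) : ℝ := (1 - q ^ m) / (1 - q)

/-- The q-factorial [m]! = [1][2]⋯[m]. -/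
noncomputable def qFact (q : ℝ) (m : ℕ) : ℝ := ∏ i ∈ Finset.range m, qInt q (i + 1)

/-- The q-shifted factorial (a;q)_n = (1−a)(1−qa)⋯(1−q^{n−1}a). -/
noncomputable def qPoch (q a : ℝ) (n : ℕ) : ℝ := ∏ i ∈ Finset.range n, (1 - q ^ i * a)

/-- The q-hypergeometric series φ_q(α,β;γ;z) = ∑_{n≥0} (α;q)_n (β;q)_n / ((γ;q)_n (q;q)_n) · zⁿ. -/
noncomputable def qHyp (q α β γ z : ℝ) : ℝ :=
  ∑' n : ℕ, qPoch q α n * qPoch q β n / (qPoch q γ n * qPoch q q n) * z ^ n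

/-- The first q-connector C_q^{(1)}(m,n;z) = q^{mn} [m]![n]!/[m+n]! · φ_q(q^m,q^n;q^{m+n+1};z). -/
noncomputable def Cq1 (q : ℝ) (m n : ℕ) (z : ℝ) : ℝ :=
  q ^ (m * n) * (qFact q m * qFact q n / qFact q (m + n)) *
    qHyp q (q ^ m) (q ^ n) (q ^ (m + n + 1)) z

/-- The second q-connector C_q^{(2)}(m,n;z) = [m]![n]!/[m+n]! · φ_q(q^m,q^n;q^{m+n+1};qz). -/
noncomputable def Cq2 (q : ℝ) (m n : ℕ) (z : ℝ) : ℝ :=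
  (qFact q m * qFact q n / qFact q (m + n)) *
    qHyp q (q ^ m) (q ^ n) (q ^ (m + n + 1)) (q * z)

/-- An augmented index: a tuple of pairs (k_i, μ_i) with μ_i ∈ {0,1};
`true` encodes μ = 1 and `false` encodes μ = 0. -/
abbrev AugIndex := List (ℕ × Bool)

/-- All exponents k_i of the augmented index are positive integers. -/
def AugIndex.Valid (K : AugIndex) : Prop := ∀ p ∈ K, 1 ≤ p.1

/-- An augmented index is admissible if it is empty or its last entry is not (1,1). -/
def AugIndex.Admissible (K : AugIndex) : Prop := K.getLast? ≠ some (1, true)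

/-- The strictly increasing chain 0 = m_0 < m_1 < ⋯ < m_r encoded by gaps `d`:
m_i = (d_0 + 1) + ⋯ + (d_{i-1} + 1). -/
def chain {r : ℕ} (d : Fin r → ℕ) (i : ℕ) : ℕ :=
  ∑ j ∈ Finset.univ.filter (fun j : Fin r => (j : ℕ) < i), (d j + 1)

/-- The factor q^{(k−1)m_i}(μ_i + (−1)^{μ_i} q^{m_{i−1}} z^{m_i−m_{i−1}}) / [m_i]^{k_i}. -/
noncomputable def qTerm1 (q z : ℝ) (k : ℕ) (μ : Bool) (mprev mcur : ℕ) : ℝ :=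
  q ^ ((k - 1) * mcur) *
    ((if μ then 1 else 0) + (if μ then -1 else 1) * q ^ mprev * z ^ (mcur - mprev)) /
    qInt q mcur ^ k

/-- The factor (μ_i q^{m_i} + (−1)^{μ_i} z^{m_i−m_{i−1}}) / [m_i]^{k_i}. -/
noncomputable def qTerm2 (q z : ℝ) (k : ℕ) (μ : Bool) (mprev mcur : ℕ) : ℝ :=
  ((if μ then q ^ mcur else 0) + (if μ then -1 else 1) * z ^ (mcur - mprev)) /
    qInt q mcur ^ k

/-- The first q-connected sum L̃i_q^{(1)}(k̃; l̃; z). -/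
noncomputable def connSumQ1 (q : ℝ) (K L : AugIndex) (z : ℝ) : ℝ :=
  ∑' p : (Fin K.length → ℕ) × (Fin L.length → ℕ),
    (∏ i : Fin K.length,
        qTerm1 q z (K.get i).1 (K.get i).2 (chain p.1 i.val) (chain p.1 (i.val + 1))) *
    (∏ j : Fin L.length,
        qTerm1 q z (L.get j).1 (L.get j).2 (chain p.2 j.val) (chain p.2 (j.val + 1))) *
    Cq1 q (chain p.1 K.length) (chain p.2 L.length) z

/-- The second q-connected sum L̃i_q^{(2)}(k̃; l̃; z). -/
noncomputable def connSumQ2 (q : ℝ) (K L : AugIndex) (z : ℝ) : ℝ :=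
  ∑' p : (Fin K.length → ℕ) × (Fin L.length → ℕ),
    (∏ i : Fin K.length,
        qTerm2 q z (K.get i).1 (K.get i).2 (chain p.1 i.val) (chain p.1 (i.val + 1))) *
    (∏ j : Fin L.length,
        qTerm2 q z (L.get j).1 (L.get j).2 (chain p.2 j.val) (chain p.2 (j.val + 1))) *
    Cq2 q (chain p.1 K.length) (chain p.2 L.length) z

/-- Appending the letter x to the word w(k̃): increase the last exponent k_r by 1. -/
def incLast : AugIndex → AugIndex
  | [] => []
  | [p] => [(p.1 + 1, p.2)]
  | p :: q :: ps => p :: incLast (q :: ps)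

section Analytic

open scoped ENNReal
open Filter Topology

lemma qInt_nonneg {q : ℝ} (hq0 : 0 < q) (hq1 : q < 1) (m : ℕ) : 0 ≤ qInt q m :=
  div_nonneg (sub_nonneg.2 (pow_le_one₀ hq0.le hq1.le)) (sub_nonneg.2 hq1.le)

lemma one_le_qInt_succ {q : ℝ} (hq0 : 0 < q) (hq1 : q < 1) (m : ℕ) : 1 ≤ qInt q (m + 1) := by
  rw [qInt, one_le_div (sub_pos.2 hq1)]
  have : q ^ (m + 1) ≤ q := pow_le_of_le_one hq0.le hq1.le (Nat.succ_ne_zero m)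
  linarith

lemma qInt_succ_pos {q : ℝ} (hq0 : 0 < q) (hq1 : q < 1) (m : ℕ) : 0 < qInt q (m + 1) :=
  zero_lt_one.trans_le (one_le_qInt_succ hq0 hq1 m)

lemma qInt_mul_one_sub {q : ℝ} (hq1 : q < 1) (m : ℕ) : qInt q m * (1 - q) = 1 - q ^ m :=
  div_mul_cancel₀ _ (sub_pos.2 hq1).ne'

lemma qInt_add {q : ℝ} (m n : ℕ) : qInt q (m + n) = qInt q n + q ^ n * qInt q m := by
  simp only [qInt, pow_add]
  ring

lemma qFact_zero (q : ℝ) : qFact q 0 = 1 := by simp [qFact]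

lemma qFact_succ (q : ℝ) (m : ℕ) : qFact q (m + 1) = qFact q m * qInt q (m + 1) :=
  Finset.prod_range_succ _ _

lemma qFact_pos {q : ℝ} (hq0 : 0 < q) (hq1 : q < 1) (m : ℕ) : 0 < qFact q m :=
  Finset.prod_pos fun i _ => qInt_succ_pos hq0 hq1 i

lemma qFact_le_qFact_add {q : ℝ} (hq0 : 0 < q) (hq1 : q < 1) (m n : ℕ) :
    qFact q m ≤ qFact q (m + n) := by
  induction n with
  | zero => rfl
  | succ n ih =>
    rw [← add_assoc, qFact_succ]
    exact ih.trans (le_mul_of_one_le_right (qFact_pos hq0 hq1 _).le (one_le_qInt_succ hq0 hq1 _))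

lemma qPoch_zero (q a : ℝ) : qPoch q a 0 = 1 := by simp [qPoch]

lemma qPoch_succ (q a : ℝ) (n : ℕ) : qPoch q a (n + 1) = qPoch q a n * (1 - q ^ n * a) :=
  Finset.prod_range_succ _ _

lemma qPoch_succ_left (q a : ℝ) (n : ℕ) :
    qPoch q a (n + 1) = (1 - a) * qPoch q (q * a) n := by
  rw [qPoch, Finset.prod_range_succ', mul_comm]
  simp only [pow_zero, one_mul, qPoch, pow_succ, mul_assoc]

lemma qPoch_nonneg {q a : ℝ} (hq0 : 0 < q) (hq1 : q < 1) (ha0 : 0 ≤ a) (ha1 : a ≤ 1) (n : ℕ) :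
    0 ≤ qPoch q a n :=
  Finset.prod_nonneg fun _ _ => sub_nonneg.2 (mul_le_one₀ (pow_le_one₀ hq0.le hq1.le) ha0 ha1)

lemma qPoch_pos {q a : ℝ} (hq0 : 0 < q) (hq1 : q < 1) (ha0 : 0 ≤ a) (ha1 : a < 1) (n : ℕ) :
    0 < qPoch q a n :=
  Finset.prod_pos fun _ _ => sub_pos.2
    ((mul_le_of_le_one_left ha0 (pow_le_one₀ hq0.le hq1.le)).trans_lt ha1)

lemma qPoch_le_one {q a : ℝ} (hq0 : 0 < q) (hq1 : q < 1) (ha0 : 0 ≤ a) (ha1 : a ≤ 1) (n : ℕ) :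
    qPoch q a n ≤ 1 :=
  Finset.prod_le_one
    (fun _ _ => sub_nonneg.2 (mul_le_one₀ (pow_le_one₀ hq0.le hq1.le) ha0 ha1))
    (fun _ _ => sub_le_self _ (by positivity))

lemma qPoch_anti {q a b : ℝ} (hq0 : 0 < q) (hq1 : q < 1) (ha0 : 0 ≤ a) (hab : a ≤ b)
    (hb1 : b ≤ 1) (n : ℕ) : qPoch q b n ≤ qPoch q a n := by
  refine Finset.prod_le_prod (fun _ _ => sub_nonneg.2
    (mul_le_one₀ (pow_le_one₀ hq0.le hq1.le) (ha0.trans hab) hb1)) fun i _ => ?_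
  gcongr

/-- `(q^{m+1};q)_j [m]! = [m+j]! (1-q)^j`. -/
lemma qPoch_pow_succ_mul_qFact {q : ℝ} (hq1 : q < 1) (m j : ℕ) :
    qPoch q (q ^ (m + 1)) j * qFact q m = qFact q (m + j) * (1 - q) ^ j := by
  induction j with
  | zero => simp [qPoch_zero]
  | succ j ih =>
    have h := qInt_mul_one_sub hq1 (m + j + 1)
    rw [qPoch_succ, ← add_assoc, qFact_succ]
    linear_combination (1 - q ^ j * q ^ (m + 1)) * ih - qFact q (m + j) * (1 - q) ^ j * h

lemma qPoch_pow_succ {q : ℝ} (hq0 : 0 < q) (hq1 : q < 1) (m j : ℕ) :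
    qPoch q (q ^ (m + 1)) j = qFact q (m + j) * (1 - q) ^ j / qFact q m :=
  (eq_div_iff (qFact_pos hq0 hq1 m).ne').2 (qPoch_pow_succ_mul_qFact hq1 m j)

lemma qPoch_self {q : ℝ} (hq0 : 0 < q) (hq1 : q < 1) (j : ℕ) :
    qPoch q q j = qFact q j * (1 - q) ^ j := by
  simpa [qFact_zero] using qPoch_pow_succ hq0 hq1 0 j

lemma qHyp_coeff_nonneg {q α β γ : ℝ} (hq0 : 0 < q) (hq1 : q < 1) (hα0 : 0 ≤ α) (hα1 : α ≤ 1)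
    (hβ0 : 0 ≤ β) (hβ1 : β ≤ 1) (hγ0 : 0 ≤ γ) (hγ1 : γ ≤ 1) (n : ℕ) :
    0 ≤ qPoch q α n * qPoch q β n / (qPoch q γ n * qPoch q q n) :=
  div_nonneg (mul_nonneg (qPoch_nonneg hq0 hq1 hα0 hα1 n) (qPoch_nonneg hq0 hq1 hβ0 hβ1 n))
    (mul_nonneg (qPoch_nonneg hq0 hq1 hγ0 hγ1 n) (qPoch_nonneg hq0 hq1 hq0.le hq1.le n))

lemma summable_pow_div_qPoch {q z : ℝ} (hq0 : 0 < q) (hq1 : q < 1) (hz0 : 0 ≤ z) (hz1 : z < 1) :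
    Summable fun n : ℕ => z ^ n / qPoch q q n := by
  obtain ⟨r, hzr, hr1⟩ := exists_between hz1
  refine summable_of_ratio_norm_eventually_le hr1 ?_
  have hlim : Tendsto (fun n : ℕ => r * (1 - q ^ n * q)) atTop (𝓝 (r * (1 - 0 * q))) :=
    (((tendsto_pow_atTop_nhds_zero_of_lt_one hq0.le hq1).mul_const q).const_sub 1).const_mul r
  filter_upwards [hlim.eventually_const_lt (by simpa using hzr)] with n hn
  have hp := qPoch_pos hq0 hq1 hq0.le hq1 n
  have hp' := qPoch_pos hq0 hq1 hq0.le hq1 (n + 1)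
  rw [Real.norm_of_nonneg (by positivity), Real.norm_of_nonneg (by positivity), mul_div_assoc',
    div_le_div_iff₀ hp' hp, qPoch_succ]
  calc z ^ (n + 1) * qPoch q q n = z ^ n * qPoch q q n * z := by ring
    _ ≤ z ^ n * qPoch q q n * (r * (1 - q ^ n * q)) := by gcongr
    _ = r * z ^ n * (qPoch q q n * (1 - q ^ n * q)) := by ring

lemma summable_qHyp {q α β γ z : ℝ} (hq0 : 0 < q) (hq1 : q < 1) (hα1 : α ≤ 1)
    (hβ0 : 0 ≤ β) (hβ1 : β ≤ 1) (hγ0 : 0 ≤ γ) (hγ1 : γ < 1) (hγα : γ ≤ α)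
    (hz0 : 0 ≤ z) (hz1 : z < 1) :
    Summable fun n : ℕ => qPoch q α n * qPoch q β n / (qPoch q γ n * qPoch q q n) * z ^ n := by
  have hα0 := hγ0.trans hγα
  refine Summable.of_nonneg_of_le (fun n => mul_nonneg
    (qHyp_coeff_nonneg hq0 hq1 hα0 hα1 hβ0 hβ1 hγ0 hγ1.le n) (pow_nonneg hz0 n)) (fun n => ?_)
    (summable_pow_div_qPoch hq0 hq1 hz0 hz1)
  have hp := qPoch_pos hq0 hq1 hq0.le hq1 n
  have hγ := qPoch_pos hq0 hq1 hγ0 hγ1 n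
  rw [div_mul_eq_mul_div, div_le_div_iff₀ (by positivity) hp]
  have h1 : qPoch q α n * qPoch q β n ≤ qPoch q γ n * 1 :=
    mul_le_mul (qPoch_anti hq0 hq1 hγ0 hγα hα1 n) (qPoch_le_one hq0 hq1 hβ0 hβ1 n)
      (qPoch_nonneg hq0 hq1 hβ0 hβ1 n) hγ.le
  calc qPoch q α n * qPoch q β n * z ^ n * qPoch q q n
      ≤ qPoch q γ n * 1 * z ^ n * qPoch q q n := by gcongr
    _ = z ^ n * (qPoch q γ n * qPoch q q n) := by ring

/-- The coefficient of `z^j` in the first q-connector. -/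
noncomputable def cq1Coeff (q : ℝ) (m n j : ℕ) : ℝ :=
  q ^ (m * n) * (qFact q m * qFact q n / qFact q (m + n)) *
    (qPoch q (q ^ m) j * qPoch q (q ^ n) j / (qPoch q (q ^ (m + n + 1)) j * qPoch q q j))

lemma cq1Coeff_nonneg {q : ℝ} (hq0 : 0 < q) (hq1 : q < 1) (m n j : ℕ) :
    0 ≤ cq1Coeff q m n j := by
  have h := fun k => (qFact_pos hq0 hq1 k).le
  have hp := fun k : ℕ => pow_le_one₀ (n := k) hq0.le hq1.le
  exact mul_nonneg (mul_nonneg (by positivity) (div_nonneg (mul_nonneg (h _) (h _)) (h _)))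
    (qHyp_coeff_nonneg hq0 hq1 (by positivity) (hp _) (by positivity) (hp _) (by positivity)
      (hp _) j)

lemma hasSum_cq1 {q z : ℝ} (hq0 : 0 < q) (hq1 : q < 1) (hz0 : 0 ≤ z) (hz1 : z < 1) (m n : ℕ) :
    HasSum (fun j => cq1Coeff q m n j * z ^ j) (Cq1 q m n z) := by
  have hp := fun k : ℕ => pow_le_one₀ (n := k) hq0.le hq1.le
  have h := (summable_qHyp hq0 hq1 (hp m) (by positivity) (hp n) (by positivity)
    (pow_lt_one₀ hq0.le hq1 (Nat.succ_ne_zero (m + n)))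
    (pow_le_pow_of_le_one hq0.le hq1.le (by omega : m ≤ m + n + 1)) hz0 hz1).hasSum.mul_left
    (q ^ (m * n) * (qFact q m * qFact q n / qFact q (m + n)))
  simpa only [cq1Coeff, Cq1, qHyp, mul_assoc] using h

lemma cq1_nonneg {q z : ℝ} (hq0 : 0 < q) (hq1 : q < 1) (hz0 : 0 ≤ z) (hz1 : z < 1) (m n : ℕ) :
    0 ≤ Cq1 q m n z :=
  (hasSum_cq1 hq0 hq1 hz0 hz1 m n).nonneg fun j =>
    mul_nonneg (cq1Coeff_nonneg hq0 hq1 m n j) (pow_nonneg hz0 j)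

lemma ofReal_mul_cq1 {q z x : ℝ} (hq0 : 0 < q) (hq1 : q < 1) (hz0 : 0 ≤ z) (hz1 : z < 1)
    (hx : 0 ≤ x) (m n : ℕ) :
    ENNReal.ofReal (x * Cq1 q m n z) =
      ∑' j, ENNReal.ofReal (x * (cq1Coeff q m n j * z ^ j)) := by
  have h := (hasSum_cq1 hq0 hq1 hz0 hz1 m n).mul_left x
  rw [← h.tsum_eq, ENNReal.ofReal_tsum_of_nonneg _ h.summable]
  exact fun j => mul_nonneg hx (mul_nonneg (cq1Coeff_nonneg hq0 hq1 m n j) (pow_nonneg hz0 j))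

lemma cq1_comm (q : ℝ) (m n : ℕ) (z : ℝ) : Cq1 q m n z = Cq1 q n m z := by
  simp only [Cq1, qHyp, mul_comm, add_comm]

lemma cq1Coeff_succ_div_qInt {q : ℝ} (hq0 : 0 < q) (hq1 : q < 1) (m n j : ℕ) :
    cq1Coeff q (m + 1) n j / qInt q (m + 1) =
      q ^ ((m + 1) * n) * qFact q n * (qPoch q (q ^ n) j / qPoch q q j) *
        (qFact q (m + j) / qFact q (m + 1 + n + j)) := by
  have h := fun k => (qFact_pos hq0 hq1 k).ne'
  have hi := (qInt_succ_pos hq0 hq1 m).ne'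
  have hq := (sub_pos.2 hq1).ne'
  have hp := (qPoch_pos hq0 hq1 hq0.le hq1 j).ne'
  have := h m; have := h (m + j); have := h (m + 1 + n); have := h (m + 1 + n + j)
  rw [cq1Coeff, qPoch_pow_succ hq0 hq1 m, qPoch_pow_succ hq0 hq1 (m + 1 + n), qFact_succ]
  field_simp

/-- A terminating q-binomial summation. -/
lemma sum_antidiagonal_qPoch_div {q : ℝ} (hq0 : 0 < q) (hq1 : q < 1) (a : ℝ) (J : ℕ) :
    ∑ p ∈ Finset.HasAntidiagonal.antidiagonal J, a ^ p.1 * (qPoch q a p.2 / qPoch q q p.2) =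
      qPoch q (q * a) J / qPoch q q J := by
  induction J with
  | zero => simp [qPoch_zero]
  | succ J ih =>
    have hp := (qPoch_pos hq0 hq1 hq0.le hq1 J).ne'
    have hp' := (qPoch_pos hq0 hq1 hq0.le hq1 (J + 1)).ne'
    rw [Finset.Nat.sum_antidiagonal_succ]
    simp only [pow_succ', mul_assoc, ← Finset.mul_sum, ih]
    rw [qPoch_succ_left q a, qPoch_succ q (q * a)]
    rw [qPoch_succ] at hp' ⊢
    have : 1 - q ^ (J + 1) ≠ 0 := by simpa [pow_succ] using right_ne_zero_of_mul hp'
    rw [← pow_succ]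
    field_simp
    ring

/-- The coefficient of `z^{J+1}` in the common value of both sides of the `y₀`-transport. -/
noncomputable def transportCoeff (q : ℝ) (m n J : ℕ) : ℝ :=
  q ^ (m + n + m * n) * (qFact q (n + J) * qFact q (m + J)) /
    (qFact q (m + n + J + 1) * qFact q J)

lemma transportCoeff_comm (q : ℝ) (m n J : ℕ) :
    transportCoeff q m n J = transportCoeff q n m J := by
  simp only [transportCoeff, mul_comm, add_comm, add_left_comm]

lemma transportCoeff_nonneg {q : ℝ} (hq0 : 0 < q) (hq1 : q < 1) (m n J : ℕ) :
    0 ≤ transportCoeff q m n J := by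
  have h := fun k => (qFact_pos hq0 hq1 k).le
  exact div_nonneg (mul_nonneg (by positivity) (mul_nonneg (h _) (h _))) (mul_nonneg (h _) (h _))

lemma summable_transportCoeff {q z : ℝ} (hq0 : 0 < q) (hq1 : q < 1) (hz0 : 0 ≤ z) (hz1 : z < 1)
    (m n : ℕ) : Summable fun J => transportCoeff q m n J * z ^ (J + 1) := by
  have hp := fun k : ℕ => pow_le_one₀ (n := k) hq0.le hq1.le
  have h := (summable_qHyp hq0 hq1 (hp (m + 1)) (by positivity) (hp (n + 1)) (by positivity)
    (pow_lt_one₀ hq0.le hq1 (Nat.succ_ne_zero (m + n + 1)))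
    (pow_le_pow_of_le_one hq0.le hq1.le (by omega : m + 1 ≤ m + n + 1 + 1)) hz0 hz1).mul_left
    (z * q ^ (m + n + m * n) * (qFact q m * qFact q n / qFact q (m + n + 1)))
  refine h.congr fun J => ?_
  have h := fun k => (qFact_pos hq0 hq1 k).ne'
  have hq := (sub_pos.2 hq1).ne'
  have := h m; have := h n; have := h J; have := h (m + n + 1); have := h (m + n + J + 1)
  rw [qPoch_pow_succ hq0 hq1 m, qPoch_pow_succ hq0 hq1 n, qPoch_pow_succ hq0 hq1 (m + n + 1),
    qPoch_self hq0 hq1, transportCoeff, show m + n + 1 + J = m + n + J + 1 by ring]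
  field_simp
  ring

lemma tsum_prod_antidiagonal (f : ℕ → ℕ → ℝ≥0∞) :
    ∑' (d : ℕ) (j : ℕ), f d j = ∑' J, ∑ p ∈ Finset.HasAntidiagonal.antidiagonal J, f p.1 p.2 := by
  rw [← ENNReal.tsum_prod, ← Finset.HasAntidiagonal.sigmaAntidiagonalEquivProd.tsum_eq, ENNReal.tsum_sigma']
  refine tsum_congr fun J => ?_
  rw [tsum_fintype, ← Finset.sum_coe_sort (Finset.HasAntidiagonal.antidiagonal J)]
  rfl

/-- The value of the inner sum created by appending `y₀`. -/
lemma tsum_y_zero {q z : ℝ} (hq0 : 0 < q) (hq1 : q < 1) (hz0 : 0 ≤ z) (hz1 : z < 1) (m n : ℕ) :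
    ∑' d : ℕ, ENNReal.ofReal
        (q ^ m * z ^ (d + 1) / qInt q (m + d + 1) * Cq1 q (m + d + 1) n z) =
      ∑' J, ENNReal.ofReal (transportCoeff q m n J * z ^ (J + 1)) := by
  have hterm (d j : ℕ) : q ^ m * z ^ (d + 1) / qInt q (m + d + 1) *
      (cq1Coeff q (m + d + 1) n j * z ^ j) = q ^ (m + n + m * n) * qFact q n *
        (qFact q (m + (d + j)) / qFact q (m + n + (d + j) + 1)) * z ^ (d + j + 1) *
        ((q ^ n) ^ d * (qPoch q (q ^ n) j / qPoch q q j)) := by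
    have h := cq1Coeff_succ_div_qInt hq0 hq1 (m + d) n j
    rw [show m + d + 1 + n + j = m + n + (d + j) + 1 by ring, add_assoc m d j] at h
    calc _ = q ^ m * z ^ (d + j + 1) * (cq1Coeff q (m + d + 1) n j / qInt q (m + d + 1)) := by ring
      _ = _ := by rw [h]; ring
  have hpos (d j : ℕ) : 0 ≤ q ^ m * z ^ (d + 1) / qInt q (m + d + 1) *
      (cq1Coeff q (m + d + 1) n j * z ^ j) :=
    mul_nonneg (div_nonneg (by positivity) (qInt_nonneg hq0 hq1 _))
      (mul_nonneg (cq1Coeff_nonneg hq0 hq1 _ _ _) (by positivity))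
  calc _ = ∑' (d : ℕ) (j : ℕ), ENNReal.ofReal (q ^ m * z ^ (d + 1) / qInt q (m + d + 1) *
      (cq1Coeff q (m + d + 1) n j * z ^ j)) := tsum_congr fun d =>
        ofReal_mul_cq1 hq0 hq1 hz0 hz1
          (div_nonneg (by positivity) (qInt_nonneg hq0 hq1 _)) _ _
    _ = _ := by
      rw [tsum_prod_antidiagonal]
      refine tsum_congr fun J => ?_
      rw [← ENNReal.ofReal_sum_of_nonneg fun p _ => hpos p.1 p.2]
      congr 1
      have h := fun k => (qFact_pos hq0 hq1 k).ne'
      have hq := (sub_pos.2 hq1).ne'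
      have := h n; have := h J; have := h (m + n + J + 1)
      calc _ = ∑ p ∈ Finset.HasAntidiagonal.antidiagonal J, q ^ (m + n + m * n) * qFact q n *
            (qFact q (m + J) / qFact q (m + n + J + 1)) * z ^ (J + 1) *
            ((q ^ n) ^ p.1 * (qPoch q (q ^ n) p.2 / qPoch q q p.2)) :=
            Finset.sum_congr rfl fun p hp => by
              rw [hterm, Finset.HasAntidiagonal.mem_antidiagonal.1 hp]
        _ = _ := by
          rw [← Finset.mul_sum, sum_antidiagonal_qPoch_div hq0 hq1, ← pow_succ',
            qPoch_pow_succ hq0 hq1, qPoch_self hq0 hq1, transportCoeff]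
          field_simp

/-- The y₀-transport of the connector. -/
lemma tsum_y_zero_comm {q z : ℝ} (hq0 : 0 < q) (hq1 : q < 1) (hz0 : 0 ≤ z) (hz1 : z < 1)
    (m n : ℕ) :
    ∑' d : ℕ, ENNReal.ofReal
        (q ^ m * z ^ (d + 1) / qInt q (m + d + 1) * Cq1 q (m + d + 1) n z) =
      ∑' d : ℕ, ENNReal.ofReal
        (q ^ n * z ^ (d + 1) / qInt q (n + d + 1) * Cq1 q m (n + d + 1) z) := by
  simp only [cq1_comm q m, tsum_y_zero hq0 hq1 hz0 hz1, transportCoeff_comm q m n]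

lemma hasSum_qFact_ratio {q : ℝ} (hq0 : 0 < q) (hq1 : q < 1) (b n : ℕ) :
    HasSum (fun d : ℕ => q ^ ((n + 1) * (d + 1)) *
        (qFact q (b + d) / qFact q (b + d + 1 + (n + 1))))
      (q ^ (n + 1) / qInt q (n + 1) * (qFact q b / qFact q (b + (n + 1)))) := by
  have h := fun k => qFact_pos hq0 hq1 k
  have hi := fun k => qInt_succ_pos hq0 hq1 k
  rw [hasSum_iff_tendsto_nat_of_nonneg fun d =>
    mul_nonneg (by positivity) (div_nonneg (h _).le (h _).le)]
  set T : ℕ → ℝ := fun d => q ^ (n + 1) / qInt q (n + 1) *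
    ((q ^ (n + 1)) ^ d * (qFact q (b + d) / qFact q (b + d + (n + 1)))) with hT
  have hsum (N : ℕ) : ∑ d ∈ Finset.range N, q ^ ((n + 1) * (d + 1)) *
      (qFact q (b + d) / qFact q (b + d + 1 + (n + 1))) = T 0 - T N := by
    rw [← Finset.sum_range_sub']
    refine Finset.sum_congr rfl fun d _ => ?_
    have e1 : qFact q (b + (d + 1)) = qFact q (b + d) * qInt q (b + d + 1) := qFact_succ q (b + d)
    have e2 : qFact q (b + (d + 1) + (n + 1)) =
        qFact q (b + d + (n + 1)) * qInt q (b + d + 1 + (n + 1)) := by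
      rw [show b + d + 1 + (n + 1) = b + d + (n + 1) + 1 by ring, ← qFact_succ]
      congr 1
      ring
    have e3 := qInt_add (q := q) (b + d + 1) (n + 1)
    have e4 : qFact q (b + d + 1 + (n + 1)) = qFact q (b + (d + 1) + (n + 1)) := by
      rw [add_assoc b d 1]
    simp only [hT]
    rw [e4, e1, e2]
    have := (h (b + d + (n + 1))).ne'
    have := (hi n).ne'
    have : qInt q (b + d + 1 + (n + 1)) ≠ 0 := (hi (b + d + 1 + n)).ne'
    field_simp
    rw [e3]
    ring
  simp only [hsum]
  have hT0 : T 0 = q ^ (n + 1) / qInt q (n + 1) * (qFact q b / qFact q (b + (n + 1))) := by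
    simp [hT]
  rw [← hT0]
  suffices hlim : Tendsto T atTop (𝓝 0) by simpa using hlim.const_sub (T 0)
  have hz : Tendsto (fun d : ℕ => (q ^ (n + 1)) ^ d *
      (qFact q (b + d) / qFact q (b + d + (n + 1)))) atTop (𝓝 0) := by
    refine squeeze_zero (fun d => mul_nonneg (by positivity) (div_nonneg (h _).le (h _).le))
      (fun d => mul_le_of_le_one_right (by positivity)
        ((div_le_one (h _)).2 (qFact_le_qFact_add hq0 hq1 _ _)))
      (tendsto_pow_atTop_nhds_zero_of_lt_one (by positivity)
        (pow_lt_one₀ hq0.le hq1 (Nat.succ_ne_zero n)))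
  simpa using hz.const_mul (q ^ (n + 1) / qInt q (n + 1))

/-- The y₁-transport of the connector. -/
lemma tsum_y_one {q z : ℝ} (hq0 : 0 < q) (hq1 : q < 1) (hz0 : 0 ≤ z) (hz1 : z < 1)
    (m n : ℕ) :
    ∑' d : ℕ, ENNReal.ofReal
        ((1 - q ^ m * z ^ (d + 1)) / qInt q (m + d + 1) * Cq1 q (m + d + 1) (n + 1) z) =
      ENNReal.ofReal (q ^ (n + 1) / qInt q (n + 1) * Cq1 q m (n + 1) z) := by
  have h := fun k => qFact_pos hq0 hq1 k
  have hi := fun k => qInt_succ_pos hq0 hq1 k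
  set A : ℕ → ℝ := fun j => q ^ ((n + 1) * m) * qFact q (n + 1) *
    (qPoch q (q ^ (n + 1)) j / qPoch q q j) * (q ^ (n + 1) / qInt q (n + 1) *
      (qFact q (m + j) / qFact q (m + j + (n + 1)))) * z ^ j with hA
  have hfull : ∑' d : ℕ, ENNReal.ofReal
      (1 / qInt q (m + d + 1) * Cq1 q (m + d + 1) (n + 1) z) = ∑' j, ENNReal.ofReal (A j) := by
    calc _ = ∑' (d : ℕ) (j : ℕ), ENNReal.ofReal (1 / qInt q (m + d + 1) *
        (cq1Coeff q (m + d + 1) (n + 1) j * z ^ j)) := tsum_congr fun d =>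
          ofReal_mul_cq1 hq0 hq1 hz0 hz1 (div_nonneg zero_le_one (hi _).le) _ _
      _ = ∑' (j : ℕ) (d : ℕ), ENNReal.ofReal (1 / qInt q (m + d + 1) *
        (cq1Coeff q (m + d + 1) (n + 1) j * z ^ j)) := ENNReal.tsum_comm
      _ = _ := by
        refine tsum_congr fun j => ?_
        have hs := ((hasSum_qFact_ratio hq0 hq1 (m + j) n).mul_left
          (q ^ ((n + 1) * m) * qFact q (n + 1) *
            (qPoch q (q ^ (n + 1)) j / qPoch q q j))).mul_right (z ^ j)
        have hs' : HasSum (fun d => 1 / qInt q (m + d + 1) *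
            (cq1Coeff q (m + d + 1) (n + 1) j * z ^ j)) (A j) := by
          refine hs.congr_fun fun d => ?_
          have e := cq1Coeff_succ_div_qInt hq0 hq1 (m + d) (n + 1) j
          rw [show m + d + 1 + (n + 1) + j = m + j + d + 1 + (n + 1) by ring,
            show m + d + j = m + j + d by ring] at e
          calc _ = cq1Coeff q (m + d + 1) (n + 1) j / qInt q (m + d + 1) * z ^ j := by ring
            _ = _ := by rw [e]; ring
        rw [← hs'.tsum_eq, ENNReal.ofReal_tsum_of_nonneg _ hs'.summable]
        exact fun d => mul_nonneg (div_nonneg zero_le_one (hi _).le)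
          (mul_nonneg (cq1Coeff_nonneg hq0 hq1 _ _ _) (by positivity))
  set R : ℕ → ℝ := fun j => q ^ (n + 1) / qInt q (n + 1) *
    (cq1Coeff q m (n + 1) j * z ^ j) with hR
  have hRpos (j : ℕ) : 0 ≤ R j := mul_nonneg (div_nonneg (by positivity) (hi _).le)
    (mul_nonneg (cq1Coeff_nonneg hq0 hq1 _ _ _) (by positivity))
  have hTpos (j : ℕ) : 0 ≤ transportCoeff q m (n + 1) j * z ^ (j + 1) :=
    mul_nonneg (transportCoeff_nonneg hq0 hq1 _ _ _) (by positivity)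
  have hA0 : A 0 = R 0 := by
    simp only [hA, hR, cq1Coeff, qPoch_zero, add_zero]
    ring
  have hAsucc (j : ℕ) : A (j + 1) = R (j + 1) + transportCoeff q m (n + 1) j * z ^ (j + 1) := by
    have hq := (sub_pos.2 hq1).ne'
    have e1 : qPoch q (q ^ m) (j + 1) = (1 - q ^ m) * qPoch q (q ^ (m + 1)) j := by
      rw [qPoch_succ_left, pow_succ']
    have e2 : qInt q (m + j + 1) = qInt q m + q ^ m * qInt q (j + 1) := by
      rw [show m + j + 1 = (j + 1) + m by ring, qInt_add]
    have e3 : qFact q (m + (j + 1)) = qFact q (m + j) * qInt q (m + j + 1) := qFact_succ q (m + j)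
    simp only [hA, hR, cq1Coeff, transportCoeff]
    rw [e1, e3, e2, ← qInt_mul_one_sub hq1 m, qPoch_pow_succ hq0 hq1, qPoch_pow_succ hq0 hq1,
      qPoch_pow_succ hq0 hq1, qPoch_self hq0 hq1, qFact_succ q n, qFact_succ q j,
      show m + (n + 1) + (j + 1) = m + (j + 1) + (n + 1) by ring,
      show m + (n + 1) + j + 1 = m + (j + 1) + (n + 1) by ring,
      show n + (j + 1) = n + 1 + j by ring]
    have := (h (m + (j + 1) + (n + 1))).ne'
    have := (h (m + (n + 1))).ne'
    have := (h m).ne'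
    have := (h n).ne'
    have := (h j).ne'
    have := (hi n).ne'
    have := (hi j).ne'
    field_simp
    ring
  have hsplit : ∑' j, ENNReal.ofReal (A j) = ∑' j, ENNReal.ofReal (R j) +
      ∑' J, ENNReal.ofReal (transportCoeff q m (n + 1) J * z ^ (J + 1)) := by
    rw [tsum_eq_zero_add' ENNReal.summable, tsum_eq_zero_add' (f := fun j => ENNReal.ofReal (R j))
      ENNReal.summable, hA0, add_assoc, ← ENNReal.tsum_add]
    simp only [hAsucc, ENNReal.ofReal_add (hRpos _) (hTpos _)]
  have hfin : ∑' J, ENNReal.ofReal (transportCoeff q m (n + 1) J * z ^ (J + 1)) ≠ ∞ := by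
    rw [← ENNReal.ofReal_tsum_of_nonneg hTpos (summable_transportCoeff hq0 hq1 hz0 hz1 _ _)]
    exact ENNReal.ofReal_ne_top
  rw [ofReal_mul_cq1 hq0 hq1 hz0 hz1 (div_nonneg (by positivity) (hi _).le),
    ← ENNReal.add_left_inj hfin, ← hsplit, ← hfull, ← tsum_y_zero hq0 hq1 hz0 hz1,
    ← ENNReal.tsum_add]
  refine tsum_congr fun d => ?_
  have hC := cq1_nonneg hq0 hq1 hz0 hz1 (m + d + 1) (n + 1)
  have hle : q ^ m * z ^ (d + 1) ≤ 1 := mul_le_one₀ (pow_le_one₀ hq0.le hq1.le) (by positivity)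
    (pow_le_one₀ hz0 hz1.le)
  rw [← ENNReal.ofReal_add (mul_nonneg (div_nonneg (sub_nonneg.2 hle) (hi _).le) hC)
    (mul_nonneg (div_nonneg (by positivity) (hi _).le) hC)]
  congr 1
  ring

end Analytic

section Sums

open scoped ENNReal

lemma chain_snoc {r : ℕ} (d : Fin r → ℕ) (a i : ℕ) (hi : i ≤ r) :
    chain (Fin.snoc (α := fun _ => ℕ) d a) i = chain d i := by
  simp only [chain, Finset.sum_filter, Fin.sum_univ_castSucc, Fin.snoc_castSucc, Fin.val_castSucc,
    Fin.val_last, if_neg hi.not_gt, add_zero]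

lemma chain_snoc_last {r : ℕ} (d : Fin r → ℕ) (a : ℕ) :
    chain (Fin.snoc (α := fun _ => ℕ) d a) (r + 1) = chain d r + a + 1 := by
  simp [chain, Finset.sum_filter, Fin.sum_univ_castSucc, add_assoc]

lemma chain_succ_pos {s : ℕ} (e : Fin (s + 1) → ℕ) : 0 < chain e (s + 1) :=
  Finset.sum_pos (fun _ _ => Nat.succ_pos _) ⟨0, by simp⟩

lemma qTerm1_nonneg {q z : ℝ} (hq0 : 0 < q) (hq1 : q < 1) (hz0 : 0 ≤ z) (hz1 : z < 1)
    (k : ℕ) (μ : Bool) (a b : ℕ) : 0 ≤ qTerm1 q z k μ a b := by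
  have hle : q ^ a * z ^ (b - a) ≤ 1 := mul_le_one₀ (pow_le_one₀ hq0.le hq1.le) (by positivity)
    (pow_le_one₀ hz0 hz1.le)
  refine div_nonneg (mul_nonneg (by positivity) ?_) (pow_nonneg (qInt_nonneg hq0 hq1 b) k)
  cases μ
  · simp only [Bool.false_eq_true, if_false, zero_add, one_mul]
    positivity
  · simp only [if_true]
    linarith

lemma qTerm1_one_false (q z : ℝ) (m d : ℕ) :
    qTerm1 q z 1 false m (m + d + 1) = q ^ m * z ^ (d + 1) / qInt q (m + d + 1) := by
  simp [qTerm1, add_assoc]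

lemma qTerm1_one_true (q z : ℝ) (m d : ℕ) :
    qTerm1 q z 1 true m (m + d + 1) = (1 - q ^ m * z ^ (d + 1)) / qInt q (m + d + 1) := by
  simp [qTerm1, add_assoc, sub_eq_add_neg]

lemma qTerm1_succ {k : ℕ} (hk : 1 ≤ k) (q z : ℝ) (μ : Bool) (a b : ℕ) :
    qTerm1 q z (k + 1) μ a b = qTerm1 q z k μ a b * (q ^ b / qInt q b) := by
  obtain ⟨k, rfl⟩ := Nat.exists_eq_add_of_le' hk
  simp only [qTerm1, Nat.add_sub_cancel, add_mul, one_mul, pow_add, pow_one]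
  ring

/-- The product of the factors attached to the first `r` entries of the sequence `k`. -/
noncomputable def chainWeight (q z : ℝ) {r : ℕ} (k : ℕ → ℕ × Bool) (d : Fin r → ℕ) : ℝ :=
  ∏ i : Fin r, qTerm1 q z (k i).1 (k i).2 (chain d i) (chain d (i + 1))

lemma chainWeight_nonneg {q z : ℝ} (hq0 : 0 < q) (hq1 : q < 1) (hz0 : 0 ≤ z) (hz1 : z < 1)
    {r : ℕ} (k : ℕ → ℕ × Bool) (d : Fin r → ℕ) : 0 ≤ chainWeight q z k d :=
  Finset.prod_nonneg fun _ _ => qTerm1_nonneg hq0 hq1 hz0 hz1 _ _ _ _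

lemma chainWeight_congr (q z : ℝ) {r : ℕ} {k k' : ℕ → ℕ × Bool} (h : ∀ i < r, k i = k' i)
    (d : Fin r → ℕ) : chainWeight q z k d = chainWeight q z k' d :=
  Finset.prod_congr rfl fun i _ => by rw [h i i.2]

lemma chainWeight_snoc (q z : ℝ) {r : ℕ} (k : ℕ → ℕ × Bool) (d : Fin r → ℕ) (a : ℕ) :
    chainWeight q z k (Fin.snoc (α := fun _ => ℕ) d a : Fin (r + 1) → ℕ) =
      chainWeight q z k d * qTerm1 q z (k r).1 (k r).2 (chain d r) (chain d r + a + 1) := by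
  rw [chainWeight, Fin.prod_univ_castSucc, Fin.val_last, chain_snoc_last, chain_snoc _ _ _ le_rfl]
  congr 1
  refine Finset.prod_congr rfl fun i _ => ?_
  rw [Fin.val_castSucc, chain_snoc _ _ _ i.2.le, chain_snoc _ _ _ i.2]

/-- The first q-connected sum of two sequences truncated at lengths `r` and `s`, as an extended
nonnegative real. -/
noncomputable def connSumENN (q z : ℝ) (r s : ℕ) (k l : ℕ → ℕ × Bool) : ℝ≥0∞ :=
  ∑' (d : Fin r → ℕ) (e : Fin s → ℕ),
    ENNReal.ofReal (chainWeight q z k d * chainWeight q z l e * Cq1 q (chain d r) (chain e s) z)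

lemma connSumQ1_eq_toReal {q z : ℝ} (hq0 : 0 < q) (hq1 : q < 1) (hz0 : 0 ≤ z) (hz1 : z < 1)
    (K L : AugIndex) : connSumQ1 q K L z = (connSumENN q z K.length L.length
      (fun i => K.getD i (1, false)) (fun i => L.getD i (1, false))).toReal := by
  rw [connSumENN, ← ENNReal.tsum_prod, ENNReal.tsum_toReal_eq fun _ => ENNReal.ofReal_ne_top]
  refine tsum_congr fun p => ?_
  rw [ENNReal.toReal_ofReal (mul_nonneg (mul_nonneg (chainWeight_nonneg hq0 hq1 hz0 hz1 _ _)
    (chainWeight_nonneg hq0 hq1 hz0 hz1 _ _)) (cq1_nonneg hq0 hq1 hz0 hz1 _ _))]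
  simp [chainWeight]

lemma connSumENN_comm (q z : ℝ) (r s : ℕ) (k l : ℕ → ℕ × Bool) :
    connSumENN q z r s k l = connSumENN q z s r l k := by
  rw [connSumENN, ENNReal.tsum_comm]
  simp only [connSumENN, cq1_comm q (chain _ r), mul_comm (chainWeight q z k _)]

lemma connSumENN_congr (q z : ℝ) {r s : ℕ} {k k' l l' : ℕ → ℕ × Bool} (hk : ∀ i < r, k i = k' i)
    (hl : ∀ i < s, l i = l' i) : connSumENN q z r s k l = connSumENN q z r s k' l' := by
  simp only [connSumENN, chainWeight_congr q z hk, chainWeight_congr q z hl]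

/-- Splitting off the innermost summation variable of the first index. -/
lemma connSumENN_succ {q z : ℝ} (hq0 : 0 < q) (hq1 : q < 1) (hz0 : 0 ≤ z) (hz1 : z < 1)
    (r s : ℕ) (k l : ℕ → ℕ × Bool) :
    connSumENN q z (r + 1) s k l = ∑' (d : Fin r → ℕ) (e : Fin s → ℕ),
      ENNReal.ofReal (chainWeight q z k d * chainWeight q z l e) *
        ∑' a : ℕ, ENNReal.ofReal (qTerm1 q z (k r).1 (k r).2 (chain d r) (chain d r + a + 1) *
          Cq1 q (chain d r + a + 1) (chain e s) z) := by
  rw [connSumENN, ← (Fin.snocEquiv fun _ => ℕ).tsum_eq, ENNReal.tsum_prod', ENNReal.tsum_comm]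
  refine tsum_congr fun d => ?_
  rw [ENNReal.tsum_comm]
  refine tsum_congr fun e => ?_
  rw [← ENNReal.tsum_mul_left]
  refine tsum_congr fun a => ?_
  rw [← ENNReal.ofReal_mul (mul_nonneg (chainWeight_nonneg hq0 hq1 hz0 hz1 _ _)
    (chainWeight_nonneg hq0 hq1 hz0 hz1 _ _))]
  change ENNReal.ofReal (chainWeight q z k (Fin.snoc (α := fun _ => ℕ) d a : Fin (r + 1) → ℕ) * _ *
    Cq1 q (chain (Fin.snoc (α := fun _ => ℕ) d a : Fin (r + 1) → ℕ) (r + 1)) _ z) = _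
  rw [chainWeight_snoc, chain_snoc_last]
  congr 1
  ring

lemma connSumENN_y_zero {q z : ℝ} (hq0 : 0 < q) (hq1 : q < 1) (hz0 : 0 ≤ z) (hz1 : z < 1)
    (r s : ℕ) (k l : ℕ → ℕ × Bool) (hk : k r = (1, false)) (hl : l s = (1, false)) :
    connSumENN q z (r + 1) s k l = connSumENN q z r (s + 1) k l := by
  rw [connSumENN_comm q z r (s + 1), connSumENN_succ hq0 hq1 hz0 hz1,
    connSumENN_succ hq0 hq1 hz0 hz1, ENNReal.tsum_comm]
  refine tsum_congr fun e => tsum_congr fun d => ?_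
  simp only [hk, hl, qTerm1_one_false]
  rw [tsum_y_zero_comm hq0 hq1 hz0 hz1, mul_comm (chainWeight q z k d)]
  simp only [cq1_comm q (chain d r)]

lemma connSumENN_y_one {q z : ℝ} (hq0 : 0 < q) (hq1 : q < 1) (hz0 : 0 ≤ z) (hz1 : z < 1)
    (r s : ℕ) (k l l' : ℕ → ℕ × Bool) (hk : k r = (1, true)) (hl : ∀ i < s, l' i = l i)
    (hpos : 1 ≤ (l s).1) (hls : l' s = ((l s).1 + 1, (l s).2)) :
    connSumENN q z (r + 1) (s + 1) k l = connSumENN q z r (s + 1) k l' := by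
  rw [connSumENN_succ hq0 hq1 hz0 hz1]
  refine tsum_congr fun d => tsum_congr fun e => ?_
  have hW : chainWeight q z l' e = chainWeight q z l e *
      (q ^ chain e (s + 1) / qInt q (chain e (s + 1))) := by
    simp only [chainWeight, Fin.prod_univ_castSucc, Fin.val_last, Fin.val_castSucc, hls,
      qTerm1_succ hpos, hl _ (Fin.is_lt _), mul_assoc]
  obtain ⟨n, hn⟩ := Nat.exists_eq_add_of_lt (chain_succ_pos e)
  rw [zero_add] at hn
  simp only [hk, qTerm1_one_true]
  rw [hW, hn, tsum_y_one hq0 hq1 hz0 hz1, ← ENNReal.ofReal_mul (mul_nonneg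
    (chainWeight_nonneg hq0 hq1 hz0 hz1 _ _) (chainWeight_nonneg hq0 hq1 hz0 hz1 _ _))]
  congr 1
  ring

lemma incLast_concat (L : AugIndex) (x : ℕ × Bool) :
    incLast (L ++ [x]) = L ++ [(x.1 + 1, x.2)] := by
  induction L with
  | nil => rfl
  | cons y L ih =>
    cases L with
    | nil => rfl
    | cons w L => simpa [incLast] using ih

lemma getD_concat_of_lt (L : AugIndex) (x y : ℕ × Bool) {i : ℕ} (hi : i < L.length) :
    (L ++ [x]).getD i y = L.getD i y :=
  List.getD_append _ _ _ _ hi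

lemma getD_concat_length (L : AugIndex) (x y : ℕ × Bool) :
    (L ++ [x]).getD L.length y = x := by
  simp

end Sums

/-- Transport relations for the first q-connected sum:
(i) L̃i_q^{(1)}(w(k̃)y₀; w(l̃); z) = L̃i_q^{(1)}(w(k̃); w(l̃)y₀; z), and
(ii) if l̃ is non-empty, L̃i_q^{(1)}(w(k̃)y₁; w(l̃); z) = L̃i_q^{(1)}(w(k̃); w(l̃)x; z). -/
theorem q_transport_one (q : ℝ) (hq0 : 0 < q) (hq1 : q < 1)
    (z : ℝ) (hz0 : 0 ≤ z) (hz1 : z < 1) (K L : AugIndex)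
    (hK : K.Valid) (hL : L.Valid) :
    connSumQ1 q (K ++ [(1, false)]) L z = connSumQ1 q K (L ++ [(1, false)]) z ∧
      (L ≠ [] → connSumQ1 q (K ++ [(1, true)]) L z = connSumQ1 q K (incLast L) z) := by
  constructor
  · rw [connSumQ1_eq_toReal hq0 hq1 hz0 hz1, connSumQ1_eq_toReal hq0 hq1 hz0 hz1,
      List.length_append, List.length_append, List.length_singleton]
    congr 1
    rw [connSumENN_congr q z (l' := fun i => (L ++ [(1, false)]).getD i (1, false))
        (fun _ _ => rfl) (fun i hi => (getD_concat_of_lt L _ _ hi).symm),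
      connSumENN_y_zero hq0 hq1 hz0 hz1 _ _ _ _ (getD_concat_length K _ _)
        (getD_concat_length L _ _)]
    exact connSumENN_congr q z (fun i hi => getD_concat_of_lt K _ _ hi) (fun _ _ => rfl)
  · intro hne
    obtain ⟨L, x, rfl⟩ := (List.eq_nil_or_concat' L).resolve_left hne
    rw [incLast_concat, connSumQ1_eq_toReal hq0 hq1 hz0 hz1, connSumQ1_eq_toReal hq0 hq1 hz0 hz1]
    simp only [List.length_append, List.length_singleton]
    congr 1
    rw [connSumENN_y_one hq0 hq1 hz0 hz1 _ _ _ _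
      (fun i => (L ++ [(x.1 + 1, x.2)]).getD i (1, false)) (getD_concat_length K _ _)
      (fun i hi => by rw [getD_concat_of_lt L _ _ hi, getD_concat_of_lt L _ _ hi])
      (by rw [getD_concat_length]; exact hL x (by simp))
      (by rw [getD_concat_length, getD_concat_length])]
    exact connSumENN_congr q z (fun i hi => getD_concat_of_lt K _ _ hi) (fun _ _ => rfl)
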